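/- arXiv:1910.00073 — 8 statements merged into one kernel-verified Lean document; each statement's English description precedes it below -/
import Mathlib

section
/- Let p1, p2, q1, q2 ∈ ℝ^N with p1ᵀ(q1 + q2) ≠ 0, and set A = (q1 + q2)(q1 + q2)ᵀ. Then the minimizer of λ ↦ (p2 − λ p1)ᵀ A (p2 − λ p1) over ℝ is the Marshall–Edgeworth index λ_{M-E} = (p2ᵀ(q1+q2))/(p1ᵀ(q1+q2)) = (Σ_{i=1}^N p_{i2}(q_{i1}+q_{i2}))/(Σ_{i=1}^N p_{i1}(q_{i1}+q_{i2})). -/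
open Matrix BigOperators

/-- The quadratic form of the rank-one matrix `w wᵀ` is the square of `v ⬝ᵥ w`. -/
theorem dotProduct_vecMulVec_self_mulVec {n R : Type*} [Fintype n] [CommRing R] (v w : n → R) :
    v ⬝ᵥ (Matrix.vecMulVec w w).mulVec v = (v ⬝ᵥ w) ^ 2 := by
  rw [Matrix.vecMulVec_mulVec, op_smul_eq_smul, dotProduct_smul, smul_eq_mul,
    dotProduct_comm w v, sq]

/-- With `A = (q1+q2)(q1+q2)ᵀ` and `p1ᵀ(q1+q2) ≠ 0`, the minimizer of
`λ ↦ (p2 − λ p1)ᵀ A (p2 − λ p1)` over `ℝ` is the Marshall–Edgeworth index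
`λ_{M-E} = (p2ᵀ(q1+q2))/(p1ᵀ(q1+q2)) = (Σ_i p_{i2}(q_{i1}+q_{i2}))/(Σ_i p_{i1}(q_{i1}+q_{i2}))`. -/
theorem stmt3 {N : ℕ} (p1 p2 q1 q2 : Fin N → ℝ) (hq : p1 ⬝ᵥ (q1 + q2) ≠ 0)
    (A : Matrix (Fin N) (Fin N) ℝ) (hA : A = Matrix.vecMulVec (q1 + q2) (q1 + q2))
    (lamME : ℝ) (hlam : lamME = (p2 ⬝ᵥ (q1 + q2)) / (p1 ⬝ᵥ (q1 + q2))) :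
    (∀ lam : ℝ,
      (p2 - lamME • p1) ⬝ᵥ A.mulVec (p2 - lamME • p1) ≤
        (p2 - lam • p1) ⬝ᵥ A.mulVec (p2 - lam • p1)) ∧
    (∀ lam : ℝ,
      (p2 - lam • p1) ⬝ᵥ A.mulVec (p2 - lam • p1) =
        (p2 - lamME • p1) ⬝ᵥ A.mulVec (p2 - lamME • p1) → lam = lamME) ∧
    lamME = (∑ i, p2 i * (q1 i + q2 i)) / (∑ i, p1 i * (q1 i + q2 i)) := by
  have h_form (lam : ℝ) : (p2 - lam • p1) ⬝ᵥ A.mulVec (p2 - lam • p1) =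
      (p2 ⬝ᵥ (q1 + q2) - lam * (p1 ⬝ᵥ (q1 + q2))) ^ 2 := by
    rw [hA, dotProduct_vecMulVec_self_mulVec, sub_dotProduct, smul_dotProduct, smul_eq_mul]
  have h_min : (p2 - lamME • p1) ⬝ᵥ A.mulVec (p2 - lamME • p1) = 0 := by
    rw [h_form, hlam, div_mul_cancel₀ _ hq, sub_self, zero_pow two_ne_zero]
  refine ⟨fun lam => ?_, fun lam h => ?_, hlam⟩
  · rw [h_min, h_form]
    exact sq_nonneg _
  · rw [h_min, h_form, sq_eq_zero_iff, sub_eq_zero] at h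
    rw [hlam, eq_div_iff hq, h]
end

section
/- Let p1, p2, q1, q2 ∈ ℝ^N with q1, q2 having nonnegative entries, let q̃ ∈ ℝ^N be the vector with entries q̃_i = √(q_{i1} q_{i2}), and assume p1ᵀ q̃ ≠ 0. Setting A = q̃ q̃ᵀ, the minimizer of λ ↦ (p2 − λ p1)ᵀ A (p2 − λ p1) over ℝ is the Walsh index λ_W = (p2ᵀ q̃)/(p1ᵀ q̃) = (Σ_{i=1}^N p_{i2} (q_{i1} q_{i2})^{1/2})/(Σ_{i=1}^N p_{i1} (q_{i1} q_{i2})^{1/2}). -/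
open Matrix BigOperators

/-- The quadratic form of the rank-one matrix `v vᵀ` is the square of the pairing with `v`. -/
theorem dotProduct_vecMulVec_mulVec_self {n R : Type*} [Fintype n] [CommRing R] (x v : n → R) :
    x ⬝ᵥ (vecMulVec v v).mulVec x = (x ⬝ᵥ v) ^ 2 := by
  rw [vecMulVec_mulVec, op_smul_eq_smul, dotProduct_smul, smul_eq_mul, dotProduct_comm v x, sq]

/-- With `q̃_i = √(q_{i1} q_{i2})` (for nonnegative quantity vectors),
`A = q̃ q̃ᵀ` and `p1ᵀ q̃ ≠ 0`, the minimizer of `λ ↦ (p2 − λ p1)ᵀ A (p2 − λ p1)` over `ℝ`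
is the Walsh index
`λ_W = (p2ᵀ q̃)/(p1ᵀ q̃) = (Σ_i p_{i2} (q_{i1} q_{i2})^{1/2})/(Σ_i p_{i1} (q_{i1} q_{i2})^{1/2})`. -/
theorem stmt4 {N : ℕ} (p1 p2 q1 q2 : Fin N → ℝ)
    (hq1 : ∀ i, 0 ≤ q1 i) (hq2 : ∀ i, 0 ≤ q2 i)
    (qtil : Fin N → ℝ) (hqtil : ∀ i, qtil i = Real.sqrt (q1 i * q2 i))
    (hq : p1 ⬝ᵥ qtil ≠ 0)
    (A : Matrix (Fin N) (Fin N) ℝ) (hA : A = Matrix.vecMulVec qtil qtil)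
    (lamW : ℝ) (hlam : lamW = (p2 ⬝ᵥ qtil) / (p1 ⬝ᵥ qtil)) :
    (∀ lam : ℝ,
      (p2 - lamW • p1) ⬝ᵥ A.mulVec (p2 - lamW • p1) ≤
        (p2 - lam • p1) ⬝ᵥ A.mulVec (p2 - lam • p1)) ∧
    (∀ lam : ℝ,
      (p2 - lam • p1) ⬝ᵥ A.mulVec (p2 - lam • p1) =
        (p2 - lamW • p1) ⬝ᵥ A.mulVec (p2 - lamW • p1) → lam = lamW) ∧
    lamW = (∑ i, p2 i * Real.sqrt (q1 i * q2 i)) / (∑ i, p1 i * Real.sqrt (q1 i * q2 i)) := by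
  have key : ∀ lam : ℝ, (p2 - lam • p1) ⬝ᵥ A.mulVec (p2 - lam • p1) =
      (p2 ⬝ᵥ qtil - lam * (p1 ⬝ᵥ qtil)) ^ 2 := fun lam => by
    rw [hA, dotProduct_vecMulVec_mulVec_self, sub_dotProduct, smul_dotProduct, smul_eq_mul]
  have hzero : p2 ⬝ᵥ qtil - lamW * (p1 ⬝ᵥ qtil) = 0 := by
    rw [hlam, div_mul_cancel₀ _ hq, sub_self]
  refine ⟨fun lam => ?_, fun lam h => ?_, ?_⟩
  · rw [key, key, hzero, zero_pow two_ne_zero]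
    positivity
  · rw [key, key, hzero, zero_pow two_ne_zero, sq_eq_zero_iff] at h
    exact mul_right_cancel₀ hq (by linarith)
  · simp only [hlam, dotProduct, hqtil]
end

section
/- Let V1 and Q1 be N×(T−1) real matrices, v1, q1 ∈ ℝ^N, and define A = I_{T−1} ⊙ (V1ᵀ V1), B = Q1ᵀ ⊙ V1ᵀ (a (T−1)×N matrix), and C = (q1 q1ᵀ + Q1 Q1ᵀ) ⊙ I_N (an N×N matrix). Assume C is invertible and the Schur complement A − B C⁻¹ Bᵀ is invertible. Then the block linear system A δ − B p̃ = 0, −Bᵀ δ + C p̃ = q1 ⊙ v1 (the normal equations of the stochastic-approach regression for the MPL deflator) has a unique solution (δ, p̃), and its deflator component is δ̂ = { (I_{T−1} ⊙ V1ᵀV1) − (Q1ᵀ ⊙ V1ᵀ)[(q1q1ᵀ + Q1Q1ᵀ) ⊙ I_N]⁻¹ (Q1 ⊙ V1) }⁻¹ (Q1ᵀ ⊙ V1ᵀ)[(q1q1ᵀ + Q1Q1ᵀ) ⊙ I_N]⁻¹ (q1 ⊙ v1). -/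
open Matrix BigOperators

theorem Matrix.mulVec_eq_iff_eq_inv_mulVec {n R : Type*} [Fintype n] [DecidableEq n] [CommRing R]
    {M : Matrix n n R} (hM : IsUnit M.det) {x y : n → R} :
    M *ᵥ x = y ↔ x = M⁻¹ *ᵥ y := by
  constructor
  · rintro rfl
    rw [mulVec_mulVec, nonsing_inv_mul M hM, one_mulVec]
  · rintro rfl
    rw [mulVec_mulVec, mul_nonsing_inv M hM, one_mulVec]

/-- Block elimination: a linear system whose lower right block and Schur complement are
invertible is solved by back substitution. -/
theorem Matrix.block_system_iff {m n R : Type*} [Fintype m] [DecidableEq m] [Fintype n]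
    [DecidableEq n] [CommRing R] {A : Matrix m m R} {B : Matrix m n R} {D : Matrix n m R}
    {C : Matrix n n R} (hC : IsUnit C.det) (hS : IsUnit (A - B * C⁻¹ * D).det)
    {x : m → R} {y w : n → R} :
    (A *ᵥ x - B *ᵥ y = 0 ∧ -(D *ᵥ x) + C *ᵥ y = w) ↔
      x = (A - B * C⁻¹ * D)⁻¹ *ᵥ ((B * C⁻¹) *ᵥ w) ∧ y = C⁻¹ *ᵥ (D *ᵥ x + w) := by
  rw [neg_add_eq_iff_eq_add, mulVec_eq_iff_eq_inv_mulVec hC,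
    ← mulVec_eq_iff_eq_inv_mulVec hS]
  refine and_congr_left ?_
  rintro rfl
  rw [sub_eq_zero, sub_mulVec, sub_eq_iff_eq_add, mulVec_mulVec, mulVec_add, mulVec_mulVec,
    add_comm]

/-- With `A = I_{T−1} ⊙ (V1ᵀV1)`, `B = Q1ᵀ ⊙ V1ᵀ`,
`C = (q1q1ᵀ + Q1Q1ᵀ) ⊙ I_N`, `C` invertible and the Schur complement `A − B C⁻¹ Bᵀ`
invertible, the block normal equations `A δ − B p̃ = 0`, `−Bᵀ δ + C p̃ = q1 ⊙ v1`
have a unique solution `(δ, p̃)`, whose deflator component is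
`δ̂ = (A − B C⁻¹ Bᵀ)⁻¹ B C⁻¹ (q1 ⊙ v1)`. -/
theorem stmt5 {N T : ℕ}
    (V1 Q1 : Matrix (Fin N) (Fin (T - 1)) ℝ)
    (v1 q1 : Fin N → ℝ)
    (A : Matrix (Fin (T - 1)) (Fin (T - 1)) ℝ)
    (B : Matrix (Fin (T - 1)) (Fin N) ℝ)
    (C : Matrix (Fin N) (Fin N) ℝ)
    (hA : A = Matrix.hadamard (1 : Matrix (Fin (T - 1)) (Fin (T - 1)) ℝ) (V1ᵀ * V1))
    (hB : B = Matrix.hadamard Q1ᵀ V1ᵀ)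
    (hC : C = Matrix.hadamard (Matrix.vecMulVec q1 q1 + Q1 * Q1ᵀ)
      (1 : Matrix (Fin N) (Fin N) ℝ))
    (hCinv : IsUnit C.det)
    (hSinv : IsUnit (A - B * C⁻¹ * Bᵀ).det) :
    (∃! dp : (Fin (T - 1) → ℝ) × (Fin N → ℝ),
        A.mulVec dp.1 - B.mulVec dp.2 = 0 ∧
        -(Bᵀ.mulVec dp.1) + C.mulVec dp.2 = q1 * v1) ∧
    ∀ δ : Fin (T - 1) → ℝ, ∀ p : Fin N → ℝ,
      (A.mulVec δ - B.mulVec p = 0 ∧ -(Bᵀ.mulVec δ) + C.mulVec p = q1 * v1) →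
      δ = (A - B * C⁻¹ * Bᵀ)⁻¹.mulVec ((B * C⁻¹).mulVec (q1 * v1)) := by
  simp only [Matrix.block_system_iff hCinv hSinv]
  set d := (A - B * C⁻¹ * Bᵀ)⁻¹ *ᵥ ((B * C⁻¹) *ᵥ (q1 * v1))
  refine ⟨⟨(d, C⁻¹ *ᵥ (Bᵀ *ᵥ d + q1 * v1)), ⟨rfl, rfl⟩, ?_⟩, fun _ _ h => h.1⟩
  rintro ⟨δ, p⟩ ⟨hδ, hp⟩
  dsimp only at hδ hp
  rw [hp, hδ]
end

section
/- Let q1, q2, v1, v2 ∈ ℝ^N have strictly positive entries and define prices p_{it} = v_{it}/q_{it} and weights π_i = 2 p_{i2} q_{i1}² q_{i2}²/(q_{i1}² + q_{i2}²). Then the two-period MPL deflator δ̂ = { Σ_{i=1}^N q_{i1}² v_{i2}²/(q_{i1}² + q_{i2}²) }⁻¹ · Σ_{i=1}^N q_{i1} q_{i2} v_{i1} v_{i2}/(q_{i1}² + q_{i2}²) (the T = 2 specialization of the MPL closed form with V1 = v2 and Q1 = q2) satisfies δ̂⁻¹ = λ̂ where λ̂ = (Σ_{i=1}^N p_{i2}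 π_i)/(Σ_{i=1}^N p_{i1} π_i). -/
open BigOperators

/-- The MPL weights `π_i = 2 p_{i2} q_{i1}² q_{i2}²/(q_{i1}² + q_{i2}²)`. -/
noncomputable def mplWeight {N : ℕ} (p2 q1 q2 : Fin N → ℝ) (i : Fin N) : ℝ :=
  2 * p2 i * (q1 i) ^ 2 * (q2 i) ^ 2 / ((q1 i) ^ 2 + (q2 i) ^ 2)

/-- the two-period MPL deflator
`δ̂ = (Σ_i q_{i1}² v_{i2}²/(q_{i1}²+q_{i2}²))⁻¹ · Σ_i q_{i1} q_{i2} v_{i1} v_{i2}/(q_{i1}²+q_{i2}²)`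
satisfies `δ̂⁻¹ = λ̂ = (Σ_i p_{i2} π_i)/(Σ_i p_{i1} π_i)` where `p_{it} = v_{it}/q_{it}`
and `π_i = 2 p_{i2} q_{i1}² q_{i2}²/(q_{i1}² + q_{i2}²)`. -/
theorem stmt6 {N : ℕ} (q1 q2 v1 v2 : Fin N → ℝ)
    (hq1 : ∀ i, 0 < q1 i) (hq2 : ∀ i, 0 < q2 i)
    (hv1 : ∀ i, 0 < v1 i) (hv2 : ∀ i, 0 < v2 i)
    (p1 p2 : Fin N → ℝ)
    (hp1 : ∀ i, p1 i = v1 i / q1 i) (hp2 : ∀ i, p2 i = v2 i / q2 i)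
    (δ : ℝ)
    (hδ : δ = (∑ i, (q1 i) ^ 2 * (v2 i) ^ 2 / ((q1 i) ^ 2 + (q2 i) ^ 2))⁻¹ *
      ∑ i, q1 i * q2 i * v1 i * v2 i / ((q1 i) ^ 2 + (q2 i) ^ 2)) :
    δ⁻¹ = (∑ i, p2 i * mplWeight p2 q1 q2 i) / (∑ i, p1 i * mplWeight p2 q1 q2 i) := by
  have hnum : ∀ i, p2 i * mplWeight p2 q1 q2 i =
      2 * ((q1 i) ^ 2 * (v2 i) ^ 2 / ((q1 i) ^ 2 + (q2 i) ^ 2)) := by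
    intro i
    have h2 := (hq2 i).ne'
    rw [mplWeight, hp2]
    field_simp
  have hden : ∀ i, p1 i * mplWeight p2 q1 q2 i =
      2 * (q1 i * q2 i * v1 i * v2 i / ((q1 i) ^ 2 + (q2 i) ^ 2)) := by
    intro i
    have h1 := (hq1 i).ne'
    have h2 := (hq2 i).ne'
    rw [mplWeight, hp1, hp2]
    field_simp
  simp_rw [hnum, hden]
  rw [← Finset.mul_sum, ← Finset.mul_sum, mul_div_mul_left _ _ two_ne_zero, hδ, mul_inv, inv_inv,
    div_eq_mul_inv]
end

section
/- Let p1, p2, q1, q2 ∈ ℝ^N have strictly positive entries, set v_{it} = p_{it} q_{it}, π_i = 2 p_{i2} q_{i1}² q_{i2}²/(q_{i1}² + q_{i2}²), and π̃_i = [v_{i1} v_{i2} q_{i1} q_{i2}/(q_{i1}² + q_{i2}²)] / Σ_{j=1}^N [v_{j1} v_{j2} q_{j1} q_{j2}/(q_{j1}² + q_{j2}²)]. Then π̃_i > 0 for all i, Σ_{i=1}^N π̃_i = 1, and the two-period MPL index satisfies λ̂ = (Σ_{i=1}^N p_{i2} π_i)/(Σ_{i=1}^N p_{i1} π_i) = Σ_{i=1}^N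 (p_{i2}/p_{i1}) π̃_i, i.e. λ̂ is a convex combination of the price relatives p_{i2}/p_{i1}. -/
open BigOperators

/-- The two-period MPL price index `λ̂ = (Σ_i p_{i2} π_i)/(Σ_i p_{i1} π_i)`. -/
noncomputable def mplIndex {N : ℕ} (p1 p2 q1 q2 : Fin N → ℝ) : ℝ :=
  (∑ i, p2 i * mplWeight p2 q1 q2 i) / (∑ i, p1 i * mplWeight p2 q1 q2 i)

/-- with values `v_{it} = p_{it} q_{it}` and normalized weights
`π̃_i = [v_{i1}v_{i2}q_{i1}q_{i2}/(q_{i1}²+q_{i2}²)] / Σ_j [v_{j1}v_{j2}q_{j1}q_{j2}/(q_{j1}²+q_{j2}²)]`,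
each `π̃_i > 0`, `Σ_i π̃_i = 1`, and the two-period MPL index is the convex combination
`λ̂ = Σ_i (p_{i2}/p_{i1}) π̃_i` of the price relatives. -/
theorem stmt7 {N : ℕ} (hN : 0 < N) (p1 p2 q1 q2 : Fin N → ℝ)
    (hp1 : ∀ i, 0 < p1 i) (hp2 : ∀ i, 0 < p2 i)
    (hq1 : ∀ i, 0 < q1 i) (hq2 : ∀ i, 0 < q2 i)
    (v1 v2 : Fin N → ℝ)
    (hv1 : ∀ i, v1 i = p1 i * q1 i) (hv2 : ∀ i, v2 i = p2 i * q2 i)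
    (πtil : Fin N → ℝ)
    (hπtil : ∀ i, πtil i =
      (v1 i * v2 i * (q1 i * q2 i / ((q1 i) ^ 2 + (q2 i) ^ 2))) /
        ∑ j, v1 j * v2 j * (q1 j * q2 j / ((q1 j) ^ 2 + (q2 j) ^ 2))) :
    (∀ i, 0 < πtil i) ∧
    (∑ i, πtil i) = 1 ∧
    mplIndex p1 p2 q1 q2 = ∑ i, (p2 i / p1 i) * πtil i := by
  have hw : ∀ i, v1 i * v2 i * (q1 i * q2 i / ((q1 i) ^ 2 + (q2 i) ^ 2)) =
      p1 i * mplWeight p2 q1 q2 i / 2 := by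
    intro i
    rw [hv1, hv2, mplWeight]
    ring
  have hpos : ∀ i, 0 < p1 i * mplWeight p2 q1 q2 i := by
    intro i
    have h1 := hp1 i
    have h2 := hp2 i
    have h3 := hq1 i
    have h4 := hq2 i
    unfold mplWeight
    positivity
  have hsum : 0 < ∑ i, p1 i * mplWeight p2 q1 q2 i :=
    Finset.sum_pos (fun i _ => hpos i) ⟨⟨0, hN⟩, Finset.mem_univ _⟩
  have hπ : ∀ i, πtil i =
      p1 i * mplWeight p2 q1 q2 i / ∑ j, p1 j * mplWeight p2 q1 q2 j := by
    intro i
    rw [hπtil]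
    simp only [hw]
    rw [← Finset.sum_div, div_div_div_cancel_right₀ two_ne_zero]
  refine ⟨fun i => ?_, ?_, ?_⟩
  · rw [hπ]
    exact div_pos (hpos i) hsum
  · simp only [hπ]
    rw [← Finset.sum_div, div_self hsum.ne']
  · rw [mplIndex, Finset.sum_div]
    refine Finset.sum_congr rfl fun i _ => ?_
    rw [hπ, ← mul_div_assoc, ← mul_assoc, div_mul_cancel₀ _ (hp1 i).ne']
end

section
/- Commensurability: for p1, p2, q1, q2, γ ∈ ℝ^N with strictly positive entries, λ̂(γ ⊙ p1, γ ⊙ p2, γ⁻¹ ⊙ q1, γ⁻¹ ⊙ q2) = λ̂(p1, p2, q1, q2), where γ ⊙ p has entries γ_i p_i and γ⁻¹ ⊙ q has entries q_i/γ_i; i.e. the two-period MPL index is invariant under a change of units of measurement of each commodity. -/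
open BigOperators

/-- Changing units by `γ` divides each MPL weight by the corresponding factor. -/
theorem mplWeight_rescale {N : ℕ} (p2 q1 q2 γ : Fin N → ℝ) {i : Fin N}
    (hq1 : q1 i ≠ 0) (hγ : γ i ≠ 0) :
    mplWeight (γ * p2) (γ⁻¹ * q1) (γ⁻¹ * q2) i = (γ i)⁻¹ * mplWeight p2 q1 q2 i := by
  have hq : (q1 i) ^ 2 + (q2 i) ^ 2 ≠ 0 := by positivity
  have hden : ((γ i)⁻¹ * q1 i) ^ 2 + ((γ i)⁻¹ * q2 i) ^ 2
      = ((q1 i) ^ 2 + (q2 i) ^ 2) / (γ i) ^ 2 := by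
    field_simp
  simp only [mplWeight, Pi.mul_apply, Pi.inv_apply, hden]
  field_simp

/-- Expenditure terms `p_i π_i` do not depend on the units of measurement. -/
theorem mul_mplWeight_rescale {N : ℕ} (p p2 q1 q2 γ : Fin N → ℝ) {i : Fin N}
    (hq1 : q1 i ≠ 0) (hγ : γ i ≠ 0) :
    (γ * p) i * mplWeight (γ * p2) (γ⁻¹ * q1) (γ⁻¹ * q2) i = p i * mplWeight p2 q1 q2 i := by
  rw [mplWeight_rescale p2 q1 q2 γ hq1 hγ, Pi.mul_apply]
  field_simp

/-- Commensurability: the two-period MPL index is invariant under a change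
of units of measurement of each commodity:
`λ̂(γ ⊙ p1, γ ⊙ p2, γ⁻¹ ⊙ q1, γ⁻¹ ⊙ q2) = λ̂(p1, p2, q1, q2)`. -/
theorem stmt13 {N : ℕ} (p1 p2 q1 q2 γ : Fin N → ℝ)
    (hp1 : ∀ i, 0 < p1 i) (hp2 : ∀ i, 0 < p2 i)
    (hq1 : ∀ i, 0 < q1 i) (hq2 : ∀ i, 0 < q2 i) (hγ : ∀ i, 0 < γ i) :
    mplIndex (γ * p1) (γ * p2) (γ⁻¹ * q1) (γ⁻¹ * q2) = mplIndex p1 p2 q1 q2 := by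
  simp only [mplIndex, mul_mplWeight_rescale _ p2 q1 q2 γ (hq1 _).ne' (hγ _).ne']
end

section
/- Monotonicity: let p1, p2, q1, q2 ∈ ℝ^N have strictly positive entries and let k ∈ ℝ^N satisfy k_i > 1 for all i and k_i² > k_j for all i ≠ j. Then (i) λ̂(p1, k ⊙ p2, q1, q2) > λ̂(p1, p2, q1, q2), where the weights of λ̂(p1, k ⊙ p2, q1, q2) are recomputed from k ⊙ p2 so that the left-hand side equals (Σ_i k_i² p_{i2} π_i)/(Σ_i k_i p_{i1} π_i); and (ii) λ̂(k ⊙ p1, p2, q1, q2) < λ̂(p1, p2, q1, q2), since the weights π_i do not depend on first-period prices. -/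
open BigOperators

theorem mplWeight_pos {N : ℕ} {p2 q1 q2 : Fin N → ℝ} {i : Fin N}
    (hp2 : 0 < p2 i) (hq1 : 0 < q1 i) (hq2 : 0 < q2 i) : 0 < mplWeight p2 q1 q2 i := by
  unfold mplWeight
  positivity

theorem mplWeight_mul {N : ℕ} (k p2 q1 q2 : Fin N → ℝ) (i : Fin N) :
    mplWeight (k * p2) q1 q2 i = k i * mplWeight p2 q1 q2 i := by
  simp only [mplWeight, Pi.mul_apply]
  ring

/-- A ratio of positive sums increases when the numerator terms are scaled by factors that
all exceed the factors scaling the denominator terms. -/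
theorem sum_div_sum_lt_sum_mul_div_sum_mul {ι : Type*} [Fintype ι] [Nonempty ι]
    {a b r s : ι → ℝ} (ha : ∀ i, 0 < a i) (hb : ∀ i, 0 < b i) (hs : ∀ i, 0 < s i)
    (hsr : ∀ i j, s j < r i) :
    (∑ i, a i) / (∑ i, b i) < (∑ i, r i * a i) / (∑ i, s i * b i) := by
  have hB : 0 < ∑ i, b i := Finset.sum_pos (fun i _ => hb i) Finset.univ_nonempty
  have hS : 0 < ∑ i, s i * b i :=
    Finset.sum_pos (fun i _ => mul_pos (hs i) (hb i)) Finset.univ_nonempty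
  rw [div_lt_div_iff₀ hB hS, Finset.sum_mul_sum, Finset.sum_mul_sum]
  refine Finset.sum_lt_sum_of_nonempty Finset.univ_nonempty fun i _ =>
    Finset.sum_lt_sum_of_nonempty Finset.univ_nonempty fun j _ => ?_
  have h := mul_lt_mul_of_pos_right (hsr i j) (mul_pos (ha i) (hb j))
  linarith

/-- Monotonicity: if `k_i > 1` for all `i` and `k_i² > k_j` for all
`i ≠ j`, then (i) `λ̂(p1, k ⊙ p2, q1, q2) = (Σ_i k_i² p_{i2} π_i)/(Σ_i k_i p_{i1} π_i)
> λ̂(p1, p2, q1, q2)` (weights recomputed from `k ⊙ p2`), and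
(ii) `λ̂(k ⊙ p1, p2, q1, q2) < λ̂(p1, p2, q1, q2)` (the weights do not depend on
first-period prices). -/
theorem stmt16 {N : ℕ} (hN : 0 < N) (p1 p2 q1 q2 k : Fin N → ℝ)
    (hp1 : ∀ i, 0 < p1 i) (hp2 : ∀ i, 0 < p2 i)
    (hq1 : ∀ i, 0 < q1 i) (hq2 : ∀ i, 0 < q2 i)
    (hk : ∀ i, 1 < k i) (hk2 : ∀ i j, i ≠ j → k j < (k i) ^ 2) :
    (mplIndex p1 (k * p2) q1 q2 =
      (∑ i, (k i) ^ 2 * p2 i * mplWeight p2 q1 q2 i) /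
        (∑ i, k i * p1 i * mplWeight p2 q1 q2 i)) ∧
    mplIndex p1 p2 q1 q2 < mplIndex p1 (k * p2) q1 q2 ∧
    mplIndex (k * p1) p2 q1 q2 < mplIndex p1 p2 q1 q2 := by
  have hne : Nonempty (Fin N) := ⟨⟨0, hN⟩⟩
  have hw : ∀ i, 0 < mplWeight p2 q1 q2 i := fun i => mplWeight_pos (hp2 i) (hq1 i) (hq2 i)
  have hk0 : ∀ i, 0 < k i := fun i => one_pos.trans (hk i)
  have hlt : ∀ i j, k j < (k i) ^ 2 := fun i j => by
    by_cases h : i = j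
    · subst h
      exact lt_self_pow₀ (hk i) one_lt_two
    · exact hk2 i j h
  have hscaled : mplIndex p1 (k * p2) q1 q2 =
      (∑ i, (k i) ^ 2 * p2 i * mplWeight p2 q1 q2 i) /
        (∑ i, k i * p1 i * mplWeight p2 q1 q2 i) := by
    simp only [mplIndex, mplWeight_mul, Pi.mul_apply]
    congr 1 <;> exact Finset.sum_congr rfl fun i _ => by ring
  refine ⟨hscaled, ?_, ?_⟩
  · rw [hscaled]
    simp only [mplIndex, mul_assoc]
    exact sum_div_sum_lt_sum_mul_div_sum_mul (fun i => mul_pos (hp2 i) (hw i))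
      (fun i => mul_pos (hp1 i) (hw i)) hk0 hlt
  · unfold mplIndex
    refine div_lt_div_of_pos_left
      (Finset.sum_pos (fun i _ => mul_pos (hp2 i) (hw i)) Finset.univ_nonempty)
      (Finset.sum_pos (fun i _ => mul_pos (hp1 i) (hw i)) Finset.univ_nonempty)
      (Finset.sum_lt_sum_of_nonempty Finset.univ_nonempty fun i _ => ?_)
    exact mul_lt_mul_of_pos_right (lt_mul_of_one_lt_left (hp1 i) (hk i)) (hw i)
end

section
/- Mean-value/proportional-prices property: let p1, q1, q2 ∈ ℝ^N have strictly positive entries and let β > 0 be real. If the second-period price vector is p2 = β p1, then the two-period MPL index equals β: λ̂(p1, β p1, q1, q2) = β. Moreover, for arbitrary p2 with strictly positive entries, λ̂(p1, p2, q1, q2) > 0 (positivity). -/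
open BigOperators

theorem sum_mul_mplWeight_pos {N : ℕ} (hN : 0 < N) {p p2 q1 q2 : Fin N → ℝ}
    (hp : ∀ i, 0 < p i) (hp2 : ∀ i, 0 < p2 i) (hq1 : ∀ i, 0 < q1 i) (hq2 : ∀ i, 0 < q2 i) :
    0 < ∑ i, p i * mplWeight p2 q1 q2 i :=
  Finset.sum_pos (fun i _ => mul_pos (hp i) (mplWeight_pos (hp2 i) (hq1 i) (hq2 i)))
    ⟨⟨0, hN⟩, Finset.mem_univ _⟩

/-- Mean-value/proportional-prices property and positivity: if the
second-period price vector is `p2 = β p1` with `β > 0`, then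
`λ̂(p1, β p1, q1, q2) = β` (weights recomputed from `β p1`); and for arbitrary
strictly positive `p2`, `λ̂(p1, p2, q1, q2) > 0`. -/
theorem stmt19 {N : ℕ} (hN : 0 < N) (p1 q1 q2 : Fin N → ℝ) (β : ℝ) (hβ : 0 < β)
    (hp1 : ∀ i, 0 < p1 i) (hq1 : ∀ i, 0 < q1 i) (hq2 : ∀ i, 0 < q2 i) :
    mplIndex p1 (β • p1) q1 q2 = β ∧
    ∀ p2 : Fin N → ℝ, (∀ i, 0 < p2 i) → 0 < mplIndex p1 p2 q1 q2 := by
  refine ⟨?_, fun p2 hp2 => div_pos (sum_mul_mplWeight_pos hN hp2 hp2 hq1 hq2)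
    (sum_mul_mplWeight_pos hN hp1 hp2 hq1 hq2)⟩
  have hβp1 : ∀ i, 0 < (β • p1) i := fun i => mul_pos hβ (hp1 i)
  rw [mplIndex, div_eq_iff (sum_mul_mplWeight_pos hN hp1 hβp1 hq1 hq2).ne', Finset.mul_sum]
  simp only [Pi.smul_apply, smul_eq_mul, mul_assoc]
end
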